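/- Let B be a finite-dimensional Bol superalgebra over a field K of characteristic 0, let L(B) = B ⊕ IPS(B,B) be its standard enveloping Lie superalgebra with Killing form α, and let β be the Killing-Ricci form of B. Assume that α((D_{x,y}, x·y), z) = 0 for all homogeneous x,y,z ∈ B. Then for all homogeneous x,y,u,v ∈ B: α((D_{x,y}, x·y), (D_{u,v}, u·v)) = (−1)^{|x|(|u|+|v|+|y|)} β(y, [u,v,x]). -/

import Mathlib

open LinearMap

/-- The sign `(-1)^(i·j)` in the ground field, for parities `i j : ZMod 2`. -/
def sgn (K : Type*) [Field K] (i j : ZMod 2) : K := (-1 : K) ^ (i * j).val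

/-- A Bol superalgebra over `K`: a `ZMod 2`-graded vector space with a bilinear
product `mul` and a trilinear bracket `tri` satisfying (BS1)–(BS5) on
homogeneous elements. -/
structure BolSuper (K : Type*) (B : Type*) [Field K] [AddCommGroup B] [Module K B] where
  g : ZMod 2 → Submodule K B
  internal : DirectSum.IsInternal g
  mul : B →ₗ[K] B →ₗ[K] B
  tri : B →ₗ[K] B →ₗ[K] B →ₗ[K] B
  mul_mem : ∀ i j x y, x ∈ g i → y ∈ g j → mul x y ∈ g (i + j)
  tri_mem : ∀ i j k x y z, x ∈ g i → y ∈ g j → z ∈ g k → tri x y z ∈ g (i + j + k)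
  bs1 : ∀ i j x y, x ∈ g i → y ∈ g j → mul x y = -(sgn K i j • mul y x)
  bs2 : ∀ i j k x y z, x ∈ g i → y ∈ g j → z ∈ g k → tri x y z = -(sgn K i j • tri y x z)
  bs3 : ∀ i j k x y z, x ∈ g i → y ∈ g j → z ∈ g k →
    tri x y z + sgn K i (j + k) • tri y z x + sgn K k (i + j) • tri z x y = 0
  bs4 : ∀ i j k l m x y u v w, x ∈ g i → y ∈ g j → u ∈ g k → v ∈ g l → w ∈ g m →
    tri x y (tri u v w) = tri (tri x y u) v w + sgn K k (i + j) • tri u (tri x y v) w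
      + sgn K (i + j) (k + l) • tri u v (tri x y w)
  bs5 : ∀ i j k l x y u v, x ∈ g i → y ∈ g j → u ∈ g k → v ∈ g l →
    tri x y (mul u v) = sgn K k (i + j) • mul u (tri x y v) + mul (tri x y u) v
      + sgn K (i + j) (k + l) • tri u v (mul x y) + mul (mul x y) (mul u v)

variable {K B L : Type*} [Field K] [AddCommGroup B] [Module K B]

/-- `P` is a pseudo superderivation of degree `r` of the Bol superalgebra `A`
with companion `a ∈ A.g r`. -/
def IsPSD (A : BolSuper K B) (r : ZMod 2) (P : B →ₗ[K] B) (a : B) : Prop :=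
  a ∈ A.g r ∧
  (∀ i x, x ∈ A.g i → P x ∈ A.g (i + r)) ∧
  (∀ i j k x y z, x ∈ A.g i → y ∈ A.g j → z ∈ A.g k →
    P (A.tri x y z) = A.tri (P x) y z + sgn K r i • A.tri x (P y) z
      + sgn K r (i + j) • A.tri x y (P z)) ∧
  (∀ i j x y, x ∈ A.g i → y ∈ A.g j →
    P (A.mul x y) = sgn K r i • A.mul x (P y) + A.mul (P x) y
      + sgn K r (i + j) • A.tri x y a + A.mul a (A.mul x y))

/-- The bracket on pairs (pseudo superderivation, companion), for degrees `r`, `s`. -/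
def pbrk (A : BolSuper K B) (r s : ZMod 2)
    (pa qb : (B →ₗ[K] B) × B) : (B →ₗ[K] B) × B :=
  (pa.1 ∘ₗ qb.1 - sgn K r s • (qb.1 ∘ₗ pa.1),
   pa.1 qb.2 - sgn K r s • qb.1 pa.2 - A.mul pa.2 qb.2)

/-- The bracket on `B ⊕ H` (elements encoded as pairs `(x, (P, a))`),
for degrees `r`, `s`. -/
def lbrk (A : BolSuper K B) (r s : ZMod 2)
    (u v : B × ((B →ₗ[K] B) × B)) : B × ((B →ₗ[K] B) × B) :=
  (u.2.1 v.1 - sgn K r s • v.2.1 u.1,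
   (A.tri u.1 v.1 + (pbrk A r s u.2 v.2).1,
    A.mul u.1 v.1 + (pbrk A r s u.2 v.2).2))

/-- The degree-`r` part of the span of the inner pairs `(D_{x,u}, x·u)` with
`x` homogeneous in `B` and `u` homogeneous in the graded subspace `S`. -/
def IPSpan (A : BolSuper K B) (S : ZMod 2 → Submodule K B) (r : ZMod 2) :
    Submodule K ((B →ₗ[K] B) × B) :=
  Submodule.span K {pa | ∃ i j x u, i + j = r ∧ x ∈ A.g i ∧ u ∈ S j ∧
    pa = (A.tri x u, A.mul x u)}

/-- Data presenting a Lie superalgebra `L` as the standard enveloping Lie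
superalgebra `L(B) = B ⊕ IPS(B,B)` of the Bol superalgebra `A`, together with
the grading involution `sigma` used to define supertraces. -/
structure EnvSetup (K B L : Type*) [Field K] [AddCommGroup B] [Module K B]
    [AddCommGroup L] [Module K L] (A : BolSuper K B) where
  brk : L →ₗ[K] L →ₗ[K] L
  iota : B →ₗ[K] L
  jmap : ((B →ₗ[K] B) × B) →ₗ[K] L
  gL : ZMod 2 → Submodule K L
  gL_eq : ∀ r, gL r = (A.g r).map iota ⊔ (IPSpan A A.g r).map jmap
  surj : ∀ v : L, ∃ x pa, pa ∈ IPSpan A A.g 0 ⊔ IPSpan A A.g 1 ∧ v = iota x + jmap pa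
  inj : ∀ x pa, pa ∈ IPSpan A A.g 0 ⊔ IPSpan A A.g 1 → iota x + jmap pa = 0 →
    x = 0 ∧ pa = 0
  brk_bb : ∀ x y : B, brk (iota x) (iota y) = jmap (A.tri x y, A.mul x y)
  brk_pb : ∀ r pa, pa ∈ IPSpan A A.g r → ∀ x : B, brk (jmap pa) (iota x) = iota (pa.1 x)
  brk_bp : ∀ r s x pa, x ∈ A.g r → pa ∈ IPSpan A A.g s →
    brk (iota x) (jmap pa) = -(sgn K r s • iota (pa.1 x))
  brk_pp : ∀ r s pa qb, pa ∈ IPSpan A A.g r → qb ∈ IPSpan A A.g s →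
    brk (jmap pa) (jmap qb) = jmap (pbrk A r s pa qb)
  sigma : L →ₗ[K] L
  sigma0 : ∀ v ∈ gL 0, sigma v = v
  sigma1 : ∀ v ∈ gL 1, sigma v = -v

variable [AddCommGroup L] [Module K L]

/-- The Killing form `α(u,v) = str(ad u ∘ ad v)` of the enveloping Lie
superalgebra, the supertrace being computed via the grading involution. -/
noncomputable def killing {A : BolSuper K B} (E : EnvSetup K B L A) (u v : L) : K :=
  LinearMap.trace K L (E.sigma ∘ₗ E.brk u ∘ₗ E.brk v)

/-- The Killing-Ricci form of `B`: the restriction of the Killing form of the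
standard enveloping Lie superalgebra to `B × B`. -/
noncomputable def kr {A : BolSuper K B} (E : EnvSetup K B L A) (x y : B) : K :=
  killing E (E.iota x) (E.iota y)

theorem sgn_comm (i j : ZMod 2) : sgn K i j = sgn K j i := by
  simp only [sgn, mul_comm]

theorem sgn_add_right (i j k : ZMod 2) : sgn K i (j + k) = sgn K i j * sgn K i k := by
  have h : ∀ i j k : ZMod 2, (i * (j + k)).val % 2 = ((i * j).val + (i * k).val) % 2 := by decide
  unfold sgn
  rw [← pow_add, neg_one_pow_eq_pow_mod_two, h, ← neg_one_pow_eq_pow_mod_two]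

theorem sgn_add_left (i j k : ZMod 2) : sgn K (i + j) k = sgn K i k * sgn K j k := by
  rw [sgn_comm, sgn_add_right, sgn_comm k i, sgn_comm k j]

theorem sgn_mul_self (i j : ZMod 2) : sgn K i j * sgn K i j = 1 := by
  unfold sgn
  rw [← mul_pow]
  simp

theorem sgn_zero_left (j : ZMod 2) : sgn K 0 j = 1 := by simp [sgn]

theorem sgn_one_zero : sgn K 1 0 = 1 := by simp [sgn]

theorem sgn_one_one : sgn K 1 1 = -1 := by
  simp [sgn, show (1 : ZMod 2).val = 1 from rfl]

theorem zmod_two_eq (i : ZMod 2) : i = 0 ∨ i = 1 := by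
  revert i
  decide

namespace BolSuper

/-- The inner pair `(D_{x,y}, x·y)`. -/
def pair (A : BolSuper K B) (x y : B) : (B →ₗ[K] B) × B := (A.tri x y, A.mul x y)

variable (A : BolSuper K B)

/-- Linear maps agreeing on homogeneous elements are equal. -/
theorem hom_ext {M : Type*} [AddCommGroup M] [Module K M] {f h : B →ₗ[K] M}
    (H : ∀ i x, x ∈ A.g i → f x = h x) : f = h := by
  have htop : (⊤ : Submodule K B) ≤ LinearMap.eqLocus f h := by
    rw [← A.internal.submodule_iSup_eq_top]
    exact iSup_le fun i x hx => H i x hx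
  exact LinearMap.ext fun x => htop trivial

theorem pair_mem {i j : ZMod 2} {x y : B} (hx : x ∈ A.g i) (hy : y ∈ A.g j) :
    A.pair x y ∈ IPSpan A A.g (i + j) :=
  Submodule.subset_span ⟨i, j, x, y, rfl, hx, hy, rfl⟩

theorem pbrk_pair {i j k l : ZMod 2} {x y u v : B} (hx : x ∈ A.g i) (hy : y ∈ A.g j)
    (hu : u ∈ A.g k) (hv : v ∈ A.g l) :
    pbrk A (i + j) (k + l) (A.pair x y) (A.pair u v) =
      A.pair (A.tri x y u) v + sgn K k (i + j) • A.pair u (A.tri x y v) := by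
  refine Prod.ext ?_ ?_
  · refine A.hom_ext fun m w hw => ?_
    have := A.bs4 i j k l m x y u v w hx hy hu hv hw
    simp only [pbrk, pair, LinearMap.sub_apply, LinearMap.comp_apply, LinearMap.smul_apply,
      Prod.fst_add, Prod.smul_fst, LinearMap.add_apply, this]
    abel
  · have := A.bs5 i j k l x y u v hx hy hu hv
    simp only [pbrk, pair, Prod.snd_add, Prod.smul_snd, this]
    abel

theorem pbrk_pair_mem {i j k l : ZMod 2} {x y u v : B} (hx : x ∈ A.g i) (hy : y ∈ A.g j)
    (hu : u ∈ A.g k) (hv : v ∈ A.g l) :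
    pbrk A (i + j) (k + l) (A.pair x y) (A.pair u v) ∈ IPSpan A A.g (i + j + (k + l)) := by
  rw [A.pbrk_pair hx hy hu hv]
  refine add_mem ?_ (Submodule.smul_mem _ _ ?_)
  · have := A.pair_mem (A.tri_mem _ _ _ _ _ _ hx hy hu) hv
    rwa [add_assoc (i + j)] at this
  · have := A.pair_mem hu (A.tri_mem _ _ _ _ _ _ hx hy hv)
    rwa [add_left_comm] at this

theorem pbrk_pair_antisymm {i j k l : ZMod 2} {x y u v : B} (hx : x ∈ A.g i) (hy : y ∈ A.g j)
    (hu : u ∈ A.g k) (hv : v ∈ A.g l) :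
    pbrk A (i + j) (k + l) (A.pair x y) (A.pair u v) =
      -(sgn K (i + j) (k + l) • pbrk A (k + l) (i + j) (A.pair u v) (A.pair x y)) := by
  have h := sgn_mul_self (K := K) (i + j) (k + l)
  refine Prod.ext ?_ ?_
  · simp only [pbrk, Prod.fst_neg, Prod.smul_fst, sgn_comm (k + l) (i + j), smul_sub, smul_smul,
      h, one_smul]
    abel
  · simp only [pbrk, Prod.snd_neg, Prod.smul_snd, sgn_comm (k + l) (i + j), smul_sub, smul_smul,
      h, one_smul]
    have := A.bs1 (i + j) (k + l) _ _ (A.mul_mem _ _ _ _ hx hy) (A.mul_mem _ _ _ _ hu hv)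
    simp only [pair, this]
    abel

end BolSuper

/-- The trace computed with `s` inserted is supersymmetric on endomorphisms which commute or
anticommute with `s`. -/
theorem supertrace_comm {s f h : L →ₗ[K] L} {p q : ZMod 2}
    (hf : s ∘ₗ f = sgn K p 1 • (f ∘ₗ s)) (hh : s ∘ₗ h = sgn K q 1 • (h ∘ₗ s)) :
    LinearMap.trace K L (s ∘ₗ f ∘ₗ h) = sgn K p q * LinearMap.trace K L (s ∘ₗ h ∘ₗ f) := by
  have hcomm (a b : L →ₗ[K] L) : LinearMap.trace K L (a ∘ₗ b) = LinearMap.trace K L (b ∘ₗ a) :=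
    LinearMap.trace_mul_comm K a b
  have h1 : LinearMap.trace K L (s ∘ₗ f ∘ₗ h) =
      sgn K p 1 * LinearMap.trace K L (s ∘ₗ h ∘ₗ f) := by
    rw [← LinearMap.comp_assoc, hf, LinearMap.smul_comp, map_smul, smul_eq_mul,
      LinearMap.comp_assoc, hcomm, LinearMap.comp_assoc]
  have h2 : LinearMap.trace K L (s ∘ₗ h ∘ₗ f) =
      sgn K q 1 * LinearMap.trace K L (s ∘ₗ f ∘ₗ h) := by
    rw [← LinearMap.comp_assoc, hh, LinearMap.smul_comp, map_smul, smul_eq_mul,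
      LinearMap.comp_assoc, hcomm, LinearMap.comp_assoc]
  rcases zmod_two_eq p with rfl | rfl
  · rw [h1, sgn_zero_left, sgn_zero_left]
  · rcases zmod_two_eq q with rfl | rfl
    · rw [h2, sgn_zero_left, sgn_one_zero, one_mul, one_mul]
    · exact h1

namespace EnvSetup

variable {A : BolSuper K B} (E : EnvSetup K B L A)

/-- Linear maps on the enveloping superalgebra agreeing on homogeneous elements of `B` and on
homogeneous inner pairs are equal. -/
theorem hom_ext {M : Type*} [AddCommGroup M] [Module K M] {f h : L →ₗ[K] M}
    (hB : ∀ i x, x ∈ A.g i → f (E.iota x) = h (E.iota x))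
    (hP : ∀ i j x y, x ∈ A.g i → y ∈ A.g j →
      f (E.jmap (A.pair x y)) = h (E.jmap (A.pair x y))) : f = h := by
  have h1 : f ∘ₗ E.iota = h ∘ₗ E.iota := A.hom_ext hB
  have h2 : ∀ r, IPSpan A A.g r ≤ LinearMap.eqLocus (f ∘ₗ E.jmap) (h ∘ₗ E.jmap) := by
    intro r
    refine Submodule.span_le.2 ?_
    rintro _ ⟨i, j, x, y, -, hx, hy, rfl⟩
    exact hP i j x y hx hy
  ext v
  obtain ⟨x, pa, hpa, rfl⟩ := E.surj v
  rw [map_add, map_add]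
  exact congrArg₂ (· + ·) (LinearMap.congr_fun h1 x) (sup_le (h2 0) (h2 1) hpa)

theorem sigma_of_mem {r : ZMod 2} {v : L} (hv : v ∈ E.gL r) : E.sigma v = sgn K r 1 • v := by
  rcases zmod_two_eq r with rfl | rfl
  · rw [E.sigma0 v hv, sgn_zero_left, one_smul]
  · rw [E.sigma1 v hv, sgn_one_one, neg_smul, one_smul]

theorem sigma_iota {i : ZMod 2} {x : B} (hx : x ∈ A.g i) :
    E.sigma (E.iota x) = sgn K i 1 • E.iota x := by
  refine E.sigma_of_mem ?_
  rw [E.gL_eq]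
  exact Submodule.mem_sup_left (Submodule.mem_map_of_mem hx)

theorem sigma_jmap {r : ZMod 2} {pa : (B →ₗ[K] B) × B} (h : pa ∈ IPSpan A A.g r) :
    E.sigma (E.jmap pa) = sgn K r 1 • E.jmap pa := by
  refine E.sigma_of_mem ?_
  rw [E.gL_eq]
  exact Submodule.mem_sup_right (Submodule.mem_map_of_mem h)

theorem brk_iota_iota (x y : B) : E.brk (E.iota x) (E.iota y) = E.jmap (A.pair x y) :=
  E.brk_bb x y

theorem brk_pair_iota {i j : ZMod 2} {x y : B} (hx : x ∈ A.g i) (hy : y ∈ A.g j) (z : B) :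
    E.brk (E.jmap (A.pair x y)) (E.iota z) = E.iota (A.tri x y z) :=
  E.brk_pb _ _ (A.pair_mem hx hy) z

theorem brk_iota_pair {i k l : ZMod 2} {x u v : B} (hx : x ∈ A.g i) (hu : u ∈ A.g k)
    (hv : v ∈ A.g l) :
    E.brk (E.iota x) (E.jmap (A.pair u v)) = -(sgn K i (k + l) • E.iota (A.tri u v x)) :=
  E.brk_bp _ _ _ _ hx (A.pair_mem hu hv)

theorem brk_pair_pair {i j k l : ZMod 2} {x y u v : B} (hx : x ∈ A.g i) (hy : y ∈ A.g j)
    (hu : u ∈ A.g k) (hv : v ∈ A.g l) :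
    E.brk (E.jmap (A.pair x y)) (E.jmap (A.pair u v)) =
      E.jmap (pbrk A (i + j) (k + l) (A.pair x y) (A.pair u v)) :=
  E.brk_pp _ _ _ _ (A.pair_mem hx hy) (A.pair_mem hu hv)

theorem sigma_comp_brk_iota {i : ZMod 2} {x : B} (hx : x ∈ A.g i) :
    E.sigma ∘ₗ E.brk (E.iota x) = sgn K i 1 • (E.brk (E.iota x) ∘ₗ E.sigma) := by
  refine E.hom_ext (fun m z hz => ?_) fun k l u v hu hv => ?_
  · simp only [LinearMap.comp_apply, LinearMap.smul_apply, E.sigma_iota hz, map_smul,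
      brk_iota_iota, E.sigma_jmap (A.pair_mem hx hz), smul_smul, sgn_add_left]
  · simp only [LinearMap.comp_apply, LinearMap.smul_apply, E.sigma_jmap (A.pair_mem hu hv),
      map_smul, map_neg, E.brk_iota_pair hx hu hv,
      E.sigma_iota (A.tri_mem _ _ _ _ _ _ hu hv hx), smul_smul, sgn_add_left, smul_neg]
    congr 2
    ring

theorem sigma_comp_brk_pair {i j : ZMod 2} {x y : B} (hx : x ∈ A.g i) (hy : y ∈ A.g j) :
    E.sigma ∘ₗ E.brk (E.jmap (A.pair x y)) =
      sgn K (i + j) 1 • (E.brk (E.jmap (A.pair x y)) ∘ₗ E.sigma) := by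
  refine E.hom_ext (fun m z hz => ?_) fun k l u v hu hv => ?_
  · simp only [LinearMap.comp_apply, LinearMap.smul_apply, E.sigma_iota hz, map_smul,
      E.brk_pair_iota hx hy, E.sigma_iota (A.tri_mem _ _ _ _ _ _ hx hy hz), smul_smul,
      sgn_add_left]
  · simp only [LinearMap.comp_apply, LinearMap.smul_apply, E.sigma_jmap (A.pair_mem hu hv),
      map_smul, E.brk_pair_pair hx hy hu hv, E.sigma_jmap (A.pbrk_pair_mem hx hy hu hv),
      smul_smul, sgn_add_left]

theorem brk_pair_eq {i j : ZMod 2} {x y : B} (hx : x ∈ A.g i) (hy : y ∈ A.g j) :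
    E.brk (E.jmap (A.pair x y)) = E.brk (E.iota x) ∘ₗ E.brk (E.iota y) -
      sgn K i j • (E.brk (E.iota y) ∘ₗ E.brk (E.iota x)) := by
  refine E.hom_ext (fun k z hz => ?_) fun k l u v hu hv => ?_
  · have h3 := A.bs3 i j k x y z hx hy hz
    have h2 := A.bs2 i k j x z y hx hz hy
    simp only [LinearMap.sub_apply, LinearMap.comp_apply, LinearMap.smul_apply,
      E.brk_pair_iota hx hy, brk_iota_iota, E.brk_iota_pair hx hy hz, E.brk_iota_pair hy hx hz,
      h2, ← map_smul E.iota, ← map_neg E.iota, ← map_sub E.iota]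
    congr 1
    rw [add_assoc] at h3
    rw [eq_neg_of_add_eq_zero_left h3]
    simp only [sgn_add_right, smul_neg, neg_neg, smul_smul, sgn_comm j i, sgn_comm k i,
      sgn_comm k j]
    rw [show sgn K i j * (sgn K i j * sgn K j k * sgn K i k) =
      sgn K i k * sgn K j k * (sgn K i j * sgn K i j) by ring, sgn_mul_self, mul_one]
    abel
  · have h1 := sgn_mul_self (K := K) i k
    have h2 := sgn_mul_self (K := K) i l
    rw [E.brk_pair_pair hx hy hu hv, A.pbrk_pair_antisymm hx hy hu hv, A.pbrk_pair hu hv hx hy]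
    have hanti : A.pair (A.tri u v x) y =
        -(sgn K (k + l + i) j • A.pair y (A.tri u v x)) := by
      have hT := A.tri_mem _ _ _ _ _ _ hu hv hx
      refine Prod.ext ?_ (A.bs1 _ _ _ _ hT hy)
      exact A.hom_ext fun m w hw => A.bs2 _ _ m _ _ w hT hy hw
    simp only [LinearMap.sub_apply, LinearMap.comp_apply, LinearMap.smul_apply,
      E.brk_iota_pair hx hu hv, E.brk_iota_pair hy hu hv, brk_iota_iota, hanti,
      map_smul, map_neg, map_add]
    generalize E.jmap (A.pair y (A.tri u v x)) = a
    generalize E.jmap (A.pair x (A.tri u v y)) = b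
    simp only [sgn_add_right, sgn_add_left, sgn_comm k j, sgn_comm l j]
    have h3 := sgn_mul_self (K := K) j k
    have h4 := sgn_mul_self (K := K) j l
    match_scalars
    · linear_combination (sgn K i k * sgn K i l * sgn K i j * sgn K j l * sgn K j l) * h3 +
        (sgn K i k * sgn K i l * sgn K i j) * h4
    · linear_combination (-sgn K j k * sgn K j l * sgn K i l * sgn K i l) * h1 +
        (-sgn K j k * sgn K j l) * h2

theorem brk_brk_iota_pair_eq {i k l : ZMod 2} {x u v : B} (hx : x ∈ A.g i) (hu : u ∈ A.g k)
    (hv : v ∈ A.g l) :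
    E.brk (E.brk (E.iota x) (E.jmap (A.pair u v))) =
      E.brk (E.iota x) ∘ₗ E.brk (E.jmap (A.pair u v)) -
      sgn K i (k + l) • (E.brk (E.jmap (A.pair u v)) ∘ₗ E.brk (E.iota x)) := by
  have hT := A.tri_mem _ _ _ _ _ _ hu hv hx
  have hs := sgn_mul_self (K := K) i (k + l)
  rw [E.brk_iota_pair hx hu hv]
  refine E.hom_ext (fun m z hz => ?_) fun p q w t hw ht => ?_
  · simp only [LinearMap.sub_apply, LinearMap.comp_apply, LinearMap.smul_apply, map_neg, map_smul,
      LinearMap.neg_apply, brk_iota_iota, E.brk_pair_iota hu hv, E.brk_pair_pair hu hv hx hz,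
      A.pbrk_pair hu hv hx hz, map_add, smul_add, smul_smul, hs, one_smul]
    abel
  · have hbp := E.brk_bp _ _ _ _ hx (A.pbrk_pair_mem hu hv hw ht)
    simp only [LinearMap.sub_apply, LinearMap.comp_apply, LinearMap.smul_apply, map_neg, map_smul,
      LinearMap.neg_apply, E.brk_iota_pair hT hw ht, E.brk_iota_pair hx hw ht,
      E.brk_pair_iota hu hv, E.brk_pair_pair hu hv hw ht, hbp]
    simp only [pbrk, BolSuper.pair, LinearMap.sub_apply, LinearMap.comp_apply,
      LinearMap.smul_apply, map_sub, map_smul]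
    rw [sgn_add_right i (k + l) (p + q), sgn_add_left (k + l) i (p + q)]
    match_scalars <;> ring

theorem killing_pair_pair {i j k l : ZMod 2} {x y u v : B} (hx : x ∈ A.g i) (hy : y ∈ A.g j)
    (hu : u ∈ A.g k) (hv : v ∈ A.g l) :
    killing E (E.jmap (A.pair x y)) (E.jmap (A.pair u v)) =
      sgn K i (k + l + j) * kr E y (A.tri u v x) := by
  have hs := sgn_mul_self (K := K) i (k + l)
  have hyY : E.sigma ∘ₗ (E.brk (E.iota y) ∘ₗ E.brk (E.jmap (A.pair u v))) =
      sgn K (j + (k + l)) 1 •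
        ((E.brk (E.iota y) ∘ₗ E.brk (E.jmap (A.pair u v))) ∘ₗ E.sigma) := by
    rw [← LinearMap.comp_assoc, E.sigma_comp_brk_iota hy, LinearMap.smul_comp,
      LinearMap.comp_assoc, E.sigma_comp_brk_pair hu hv, LinearMap.comp_smul, smul_smul,
      sgn_add_left j, LinearMap.comp_assoc]
  have hcyc := supertrace_comm (E.sigma_comp_brk_iota hx) hyY
  have hT : E.iota (A.tri u v x) =
      -(sgn K i (k + l) • E.brk (E.iota x) (E.jmap (A.pair u v))) := by
    rw [E.brk_iota_pair hx hu hv, smul_neg, smul_smul, hs, one_smul, neg_neg]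
  simp only [kr, killing, hT, map_neg, map_smul, E.brk_brk_iota_pair_eq hx hu hv,
    E.brk_pair_eq hx hy, LinearMap.comp_sub, LinearMap.sub_comp, LinearMap.comp_neg,
    LinearMap.comp_smul, LinearMap.smul_comp, map_sub, smul_eq_mul, LinearMap.comp_assoc] at hcyc ⊢
  rw [hcyc]
  simp only [sgn_add_right _ (k + l) j, sgn_add_right _ j (k + l)]
  generalize LinearMap.trace K L _ = a
  generalize LinearMap.trace K L _ = b
  linear_combination (sgn K i j * b - sgn K i j * sgn K i (k + l) * a) * hs

end EnvSetup

/-- assuming `α((D_{x,y},x·y), z) = 0` for all homogeneous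
`x,y,z ∈ B`, one has
`α((D_{x,y},x·y),(D_{u,v},u·v)) = (-1)^{|x|(|u|+|v|+|y|)} β(y,[u,v,x])`. -/
theorem stmt14 {K B L : Type*} [Field K] [CharZero K]
    [AddCommGroup B] [Module K B] [FiniteDimensional K B]
    [AddCommGroup L] [Module K L] [FiniteDimensional K L]
    (A : BolSuper K B) (E : EnvSetup K B L A)
    (halpha0 : ∀ (i j k : ZMod 2) (x y z : B),
      x ∈ A.g i → y ∈ A.g j → z ∈ A.g k →
      killing E (E.jmap (A.tri x y, A.mul x y)) (E.iota z) = 0) :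
    ∀ (i j k l : ZMod 2) (x y u v : B),
      x ∈ A.g i → y ∈ A.g j → u ∈ A.g k → v ∈ A.g l →
      killing E (E.jmap (A.tri x y, A.mul x y)) (E.jmap (A.tri u v, A.mul u v))
        = sgn K i (k + l + j) * kr E y (A.tri u v x) := by
  intro i j k l x y u v hx hy hu hv
  exact E.killing_pair_pair hx hy hu hv
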